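/- arXiv:2201.01200 — 5 statements merged into one kernel-verified Lean document; each statement's English description precedes it below -/
import Mathlib

section
/- Assume 0 < m ≤ 1, 0 < β ≤ (m+1)^2/2, 0 < β < m+1, γ > 0, d_{11} ≥ 0, d_{22} ≥ 0 and ℓ > 0. Then for every n ∈ ℕ₀, T_n = (a_{11}+a_{22}) - (d_{11}+d_{22}) n^2/ℓ^2 < 0 and J_n = d_{11} d_{22} n^4/ℓ^4 - (d_{11} a_{22} + d_{22} a_{11}) n^2/ℓ^2 + (a_{11} a_{22} - a_{12} a_{21}) > 0. -/
/-- Under condition (C₀) (0 < m ≤ 1, 0 < β ≤ (m+1)²/2, β < m+1), γ > 0,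
d₁₁, d₂₂ ≥ 0, ℓ > 0, one has T_n < 0 and J_n > 0 for every n ∈ ℕ₀. -/
theorem stmt5 (m β γ d11 d22 ℓ : ℝ)
    (hm0 : 0 < m) (hm1 : m ≤ 1) (hβ0 : 0 < β) (hβ1 : β ≤ (m + 1) ^ 2 / 2) (hβ2 : β < m + 1)
    (hγ : 0 < γ) (hd11 : 0 ≤ d11) (hd22 : 0 ≤ d22) (hℓ : 0 < ℓ) :
    let a11 := 2 * β / (m + 1) ^ 2 - 1
    let a12 := β * (m - 1) / (m + 1) ^ 2
    let a21 := γ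
    let a22 := -γ
    ∀ n : ℕ,
      ((a11 + a22) - (d11 + d22) * (n : ℝ) ^ 2 / ℓ ^ 2 < 0) ∧
      (0 < d11 * d22 * (n : ℝ) ^ 4 / ℓ ^ 4 - (d11 * a22 + d22 * a11) * (n : ℝ) ^ 2 / ℓ ^ 2
          + (a11 * a22 - a12 * a21)) := by
  intro a11 a12 a21 a22 n
  have hp : 0 < (m + 1) ^ 2 := by positivity
  have h1 : a11 ≤ 0 := by
    have : 2 * β / (m + 1) ^ 2 ≤ 1 := by
      rw [div_le_one hp]; linarith
    show 2 * β / (m + 1) ^ 2 - 1 ≤ 0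
    linarith
  have h2 : a11 + a12 < 0 := by
    have e : a11 + a12 = β / (m + 1) - 1 := by
      show 2 * β / (m + 1) ^ 2 - 1 + β * (m - 1) / (m + 1) ^ 2 = β / (m + 1) - 1
      field_simp
      ring
    have : β / (m + 1) < 1 := by
      rw [div_lt_one (by linarith)]; exact hβ2
    linarith
  have h3 : a22 = -γ := rfl
  have h4 : a21 = γ := rfl
  clear_value a11 a12 a21 a22
  subst h3 h4
  constructor
  · have : 0 ≤ (d11 + d22) * (n : ℝ) ^ 2 / ℓ ^ 2 := by positivity
    linarith
  · have t1 : 0 ≤ d11 * d22 * (n : ℝ) ^ 4 / ℓ ^ 4 := by positivity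
    have t2 : 0 ≤ (d11 * a21 + d22 * (-a11)) * (n : ℝ) ^ 2 / ℓ ^ 2 := by
      have : 0 ≤ -a11 := by linarith
      positivity
    have t3 : 0 < a21 * (-(a11 + a12)) := mul_pos hγ (by linarith)
    have e : (d11 * -a21 + d22 * a11) * (n : ℝ) ^ 2 / ℓ ^ 2
        = -((d11 * a21 + d22 * (-a11)) * (n : ℝ) ^ 2 / ℓ ^ 2) := by ring
    rw [e]
    linarith
end

section
/- Assume 0 < m ≤ 1, 0 < β ≤ (m+1)^2/2, 0 < β < m+1, γ > 0, d_{11} ≥ 0, d_{22} ≥ 0 and ℓ > 0. Then for every n ∈ ℕ₀, every complex root λ of the characteristic polynomial λ^2 - T_n λ + J_n = 0 satisfies Re λ < 0, where T_n = (a_{11}+a_{22}) - (d_{11}+d_{22}) n^2/ℓ^2 and J_n = d_{11} d_{22} n^4/ℓ^4 - (d_{11} a_{22} + d_{22} a_{11}) n^2/ℓ^2 + (a_{11} a_{22} - a_{12} a_{21}). (This is the asymptotic stability of the positive steady state when the memory-based diffusion coefficient d_{21} is zero.) -/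
theorem re_neg_aux (T J : ℝ) (hT : T < 0) (hJ : 0 < J) (z : ℂ)
    (h : z ^ 2 - (T : ℂ) * z + (J : ℂ) = 0) : z.re < 0 := by
  by_contra! hx
  have h1 := congrArg Complex.re h
  have h2 := congrArg Complex.im h
  simp [pow_two] at h1 h2
  have h3 : z.im * (2 * z.re - T) = 0 := by linarith
  rcases mul_eq_zero.mp h3 with h4 | h4
  · rw [h4] at h1
    nlinarith [mul_nonneg hx hx, mul_nonneg hx (neg_nonneg.mpr hT.le)]
  · linarith

/-- Under condition (C₀), γ > 0, d₁₁, d₂₂ ≥ 0 and ℓ > 0, every complex root λ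
of λ² - T_n λ + J_n = 0 satisfies Re λ < 0 for every n ∈ ℕ₀. -/
theorem stmt6 (m β γ d11 d22 ℓ : ℝ)
    (hm0 : 0 < m) (hm1 : m ≤ 1) (hβ0 : 0 < β) (hβ1 : β ≤ (m + 1) ^ 2 / 2) (hβ2 : β < m + 1)
    (hγ : 0 < γ) (hd11 : 0 ≤ d11) (hd22 : 0 ≤ d22) (hℓ : 0 < ℓ) :
    let a11 := 2 * β / (m + 1) ^ 2 - 1
    let a12 := β * (m - 1) / (m + 1) ^ 2
    let a21 := γ
    let a22 := -γ
    ∀ n : ℕ, ∀ lam : ℂ,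
      lam ^ 2 - (((a11 + a22) - (d11 + d22) * (n : ℝ) ^ 2 / ℓ ^ 2 : ℝ) : ℂ) * lam
        + ((d11 * d22 * (n : ℝ) ^ 4 / ℓ ^ 4 - (d11 * a22 + d22 * a11) * (n : ℝ) ^ 2 / ℓ ^ 2
            + (a11 * a22 - a12 * a21) : ℝ) : ℂ) = 0 →
      lam.re < 0 := by
  intro a11 a12 a21 a22 n lam h
  have hp : (0 : ℝ) < (m + 1) ^ 2 := by positivity
  have ha : a11 ≤ 0 := by
    have : 2 * β / (m + 1) ^ 2 ≤ 1 := by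
      rw [div_le_one hp]; linarith
    simp only [a11]; linarith
  have hs : a11 + a12 < 0 := by
    have e : a11 + a12 = β / (m + 1) - 1 := by
      simp only [a11, a12]
      field_simp
      ring
    have : β / (m + 1) < 1 := by
      rw [div_lt_one (by linarith)]; exact hβ2
    linarith
  refine re_neg_aux _ _ ?_ ?_ lam h
  · have : 0 ≤ (d11 + d22) * (n : ℝ) ^ 2 / ℓ ^ 2 := by positivity
    simp only [a22]; linarith
  · have k1 : 0 ≤ d11 * d22 * (n : ℝ) ^ 4 / ℓ ^ 4 := by positivity
    have k2 : 0 ≤ (d11 * γ + d22 * (-a11)) * (n : ℝ) ^ 2 / ℓ ^ 2 := by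
      have : 0 ≤ -a11 := by linarith
      positivity
    have k3 : 0 < γ * (-(a11 + a12)) := mul_pos hγ (by linarith)
    have e : d11 * d22 * (n : ℝ) ^ 4 / ℓ ^ 4 - (d11 * a22 + d22 * a11) * (n : ℝ) ^ 2 / ℓ ^ 2
        + (a11 * a22 - a12 * a21) = d11 * d22 * (n : ℝ) ^ 4 / ℓ ^ 4
        + (d11 * γ + d22 * (-a11)) * (n : ℝ) ^ 2 / ℓ ^ 2 + γ * (-(a11 + a12)) := by
      have e1 : a22 = -γ := rfl
      have e2 : a21 = γ := rfl
      rw [e1, e2]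
      ring
    rw [e]; linarith
end

section
/- Assume 0 < m ≤ 1, 0 < β ≤ (m+1)^2/2, 0 < β < m+1, γ > 0, d_{11} ≥ 0, d_{22} ≥ 0, d_{21} ≥ 0 and ℓ > 0, and set v_* = 1 - β/(m+1). Then for every n ∈ ℕ, Γ_n(0) = J_n - d_{21} a_{12} v_* n^2/ℓ^2 > 0, where J_n = d_{11} d_{22} n^4/ℓ^4 - (d_{11} a_{22} + d_{22} a_{11}) n^2/ℓ^2 + (a_{11} a_{22} - a_{12} a_{21}); in particular λ = 0 is never a root of the characteristic equation. -/
/-- Under condition (C₀), γ > 0, d₁₁, d₂₂, d₂₁ ≥ 0, ℓ > 0 and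
v_* = 1 - β/(m+1), for every n ∈ ℕ one has Γ_n(0) = J_n - d₂₁ a₁₂ v_* n²/ℓ² > 0;
in particular λ = 0 is never a root of the characteristic equation, for any delay τ. -/
theorem stmt7 (m β γ d11 d22 d21 ℓ : ℝ)
    (hm0 : 0 < m) (hm1 : m ≤ 1) (hβ0 : 0 < β) (hβ1 : β ≤ (m + 1) ^ 2 / 2) (hβ2 : β < m + 1)
    (hγ : 0 < γ) (hd11 : 0 ≤ d11) (hd22 : 0 ≤ d22) (hd21 : 0 ≤ d21) (hℓ : 0 < ℓ) :
    let a11 : ℝ := 2 * β / (m + 1) ^ 2 - 1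
    let a12 : ℝ := β * (m - 1) / (m + 1) ^ 2
    let a21 : ℝ := γ
    let a22 : ℝ := -γ
    let v : ℝ := 1 - β / (m + 1)
    ∀ n : ℕ, 1 ≤ n →
      let Tn : ℝ := (a11 + a22) - (d11 + d22) * (n : ℝ) ^ 2 / ℓ ^ 2
      let Jn : ℝ := d11 * d22 * (n : ℝ) ^ 4 / ℓ ^ 4
          - (d11 * a22 + d22 * a11) * (n : ℝ) ^ 2 / ℓ ^ 2 + (a11 * a22 - a12 * a21)
      let R : ℝ := d21 * a12 * v * (n : ℝ) ^ 2 / ℓ ^ 2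
      0 < Jn - R ∧
      ∀ τ : ℝ, (0 : ℂ) ^ 2 - (Tn : ℂ) * 0 + (Jn : ℂ)
          - (R : ℂ) * Complex.exp (-(0 : ℂ) * (τ : ℂ)) ≠ 0 := by
  intro a11 a12 a21 a22 v n hn Tn Jn R
  have hp : 0 < m + 1 := by linarith
  have hv : 0 < v := by
    have : β / (m + 1) < 1 := (div_lt_one hp).2 hβ2
    simp only [v]
    linarith
  have h11 : a11 ≤ 0 := by
    have : 2 * β / (m + 1) ^ 2 ≤ 1 := (div_le_one (by positivity)).2 (by linarith)
    simp only [a11]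
    linarith
  have h12 : a12 ≤ 0 := by
    apply div_nonpos_of_nonpos_of_nonneg _ (by positivity)
    exact mul_nonpos_of_nonneg_of_nonpos hβ0.le (by linarith)
  have hdet : a11 * a22 - a12 * a21 = γ * v := by
    simp only [a11, a12, a21, a22, v]
    field_simp
    ring
  have h1 : 0 ≤ d11 * d22 * (n : ℝ) ^ 4 / ℓ ^ 4 := by positivity
  have h2 : (d11 * a22 + d22 * a11) * (n : ℝ) ^ 2 / ℓ ^ 2 ≤ 0 := by
    apply div_nonpos_of_nonpos_of_nonneg _ (by positivity)
    apply mul_nonpos_of_nonpos_of_nonneg _ (by positivity)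
    have e1 : d11 * a22 ≤ 0 := mul_nonpos_of_nonneg_of_nonpos hd11 (by simp only [a22]; linarith)
    have e2 : d22 * a11 ≤ 0 := mul_nonpos_of_nonneg_of_nonpos hd22 h11
    linarith
  have h3 : R ≤ 0 := by
    apply div_nonpos_of_nonpos_of_nonneg _ (by positivity)
    apply mul_nonpos_of_nonpos_of_nonneg _ (by positivity)
    exact mul_nonpos_of_nonpos_of_nonneg (mul_nonpos_of_nonneg_of_nonpos hd21 h12) hv.le
  have h4 : 0 < γ * v := mul_pos hγ hv
  have hJ : Jn = d11 * d22 * (n : ℝ) ^ 4 / ℓ ^ 4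
      - (d11 * a22 + d22 * a11) * (n : ℝ) ^ 2 / ℓ ^ 2 + (a11 * a22 - a12 * a21) := rfl
  have hmain : 0 < Jn - R := by
    rw [hJ, hdet]
    linarith
  refine ⟨hmain, fun τ h => ?_⟩
  clear_value Tn Jn R
  have h' : ((Jn - R : ℝ) : ℂ) = 0 := by
    rw [← h]
    simp
  exact hmain.ne' (Complex.ofReal_eq_zero.1 h')
end

section
/- Let T < 0, R < 0 and J be real, and let ω > 0 satisfy (J - ω^2)^2 + T^2 ω^2 = R^2. For each j ∈ ℕ₀ define τ_j = (1/ω)(arccos((J - ω^2)/R) + 2jπ). Then τ_j > 0, cos(ω τ_j) = (J - ω^2)/R, sin(ω τ_j) = T ω / R, and λ = iω is a root of the transcendental characteristic equation λ^2 - T λ + J - R e^{-λ τ_j} = 0. -/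
/-- With T < 0, R < 0, ω > 0 and (J - ω²)² + T²ω² = R², the critical delays
τ_j = (1/ω)(arccos((J - ω²)/R) + 2jπ) are positive, satisfy cos(ωτ_j) = (J - ω²)/R and
sin(ωτ_j) = Tω/R, and λ = iω is a root of λ² - Tλ + J - R e^{-λτ_j} = 0. -/
theorem stmt10 (T J R ω : ℝ) (hT : T < 0) (hR : R < 0) (hω : 0 < ω)
    (h : (J - ω ^ 2) ^ 2 + T ^ 2 * ω ^ 2 = R ^ 2) (j : ℕ) :
    let τ := (1 / ω) * (Real.arccos ((J - ω ^ 2) / R) + 2 * (j : ℝ) * Real.pi)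
    0 < τ ∧
    Real.cos (ω * τ) = (J - ω ^ 2) / R ∧
    Real.sin (ω * τ) = T * ω / R ∧
    (Complex.I * (ω : ℂ)) ^ 2 - (T : ℂ) * (Complex.I * (ω : ℂ)) + (J : ℂ)
        - (R : ℂ) * Complex.exp (-(Complex.I * (ω : ℂ)) * (τ : ℂ)) = 0 := by
  intro τ
  have hs : 0 < T * ω / R := div_pos_of_neg_of_neg (mul_neg_of_neg_of_pos hT hω) hR
  have hcs : ((J - ω ^ 2) / R) ^ 2 + (T * ω / R) ^ 2 = 1 := by
    have hR' : R ≠ 0 := hR.ne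
    field_simp
    linarith
  have hc1 : (J - ω ^ 2) / R < 1 := by nlinarith [pow_pos hs 2]
  have hc2 : -1 ≤ (J - ω ^ 2) / R := by nlinarith [pow_pos hs 2]
  have hωτ : ω * τ = Real.arccos ((J - ω ^ 2) / R) + j * (2 * Real.pi) := by
    simp only [τ]
    field_simp
  have hcos : Real.cos (ω * τ) = (J - ω ^ 2) / R := by
    rw [hωτ, Real.cos_add_nat_mul_two_pi, Real.cos_arccos hc2 hc1.le]
  have hsin : Real.sin (ω * τ) = T * ω / R := by
    rw [hωτ, Real.sin_add_nat_mul_two_pi, Real.sin_arccos,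
      show 1 - ((J - ω ^ 2) / R) ^ 2 = (T * ω / R) ^ 2 by linarith, Real.sqrt_sq hs.le]
  refine ⟨?_, hcos, hsin, ?_⟩
  · have := Real.arccos_pos.2 hc1
    have := Real.pi_pos
    positivity
  · have hexp : Complex.exp (-(Complex.I * (ω : ℂ)) * (τ : ℂ))
        = ((Real.cos (ω * τ) : ℝ) : ℂ) - ((Real.sin (ω * τ) : ℝ) : ℂ) * Complex.I := by
      rw [show -(Complex.I * (ω : ℂ)) * (τ : ℂ) = (-((ω * τ : ℝ) : ℂ)) * Complex.I by
        push_cast; ring, Complex.exp_mul_I, Complex.cos_neg, Complex.sin_neg,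
        Complex.ofReal_cos, Complex.ofReal_sin]
      ring
    have hRC : (R : ℂ) ≠ 0 := by exact_mod_cast hR.ne
    rw [hexp, hcos, hsin]
    push_cast
    field_simp
    linear_combination (ω : ℂ) ^ 2 * Complex.I_sq
end

section
/- Let T, J, R be real with R ≠ 0, set P = T^2 - 2J and Q = J^2 - R^2, and assume Q < 0. Define ω = sqrt((-P + sqrt(P^2 - 4Q))/2). Then ω > 0 and (T^2 - 2(J - ω^2))/R^2 = sqrt(P^2 - 4Q)/R^2 > 0. (This is the transversality quantity Re(dλ/dτ)^{-1} at the purely imaginary characteristic root iω, proving that the pair of characteristic roots crosses the imaginary axis from left to right at each critical delay.) -/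
/-- With R ≠ 0, P = T² - 2J, Q = J² - R² < 0 and
ω = sqrt((-P + sqrt(P² - 4Q))/2), one has ω > 0 and
(T² - 2(J - ω²))/R² = sqrt(P² - 4Q)/R² > 0 (transversality). -/
theorem stmt15 (T J R : ℝ) (hR : R ≠ 0) (hQ : J ^ 2 - R ^ 2 < 0) :
    let P := T ^ 2 - 2 * J
    let Q := J ^ 2 - R ^ 2
    let ω := Real.sqrt ((-P + Real.sqrt (P ^ 2 - 4 * Q)) / 2)
    0 < ω ∧
    (T ^ 2 - 2 * (J - ω ^ 2)) / R ^ 2 = Real.sqrt (P ^ 2 - 4 * Q) / R ^ 2 ∧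
    0 < Real.sqrt (P ^ 2 - 4 * Q) / R ^ 2 := by
  intro P Q ω
  have hQ' : Q < 0 := hQ
  have hlt : P < Real.sqrt (P ^ 2 - 4 * Q) := Real.lt_sqrt_of_sq_lt (by linarith)
  have hpos : 0 < (-P + Real.sqrt (P ^ 2 - 4 * Q)) / 2 := by linarith
  have hω : ω ^ 2 = (-P + Real.sqrt (P ^ 2 - 4 * Q)) / 2 := Real.sq_sqrt hpos.le
  have hP : P = T ^ 2 - 2 * J := rfl
  refine ⟨Real.sqrt_pos.mpr hpos, ?_, ?_⟩
  · congr 1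
    linarith
  · have h1 : 0 < P ^ 2 - 4 * Q := by nlinarith [sq_nonneg P]
    have h2 : 0 < Real.sqrt (P ^ 2 - 4 * Q) := Real.sqrt_pos.mpr h1
    positivity
end
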